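/- Let u be a real analytic function and v a harmonic function on a domain Ω ⊆ ℝ^n (n ≥ 2), with Taylor expansions at a point a ∈ Ω given by u = Σ_{i≥k} u_i and v = Σ_{i≥l} v_i into homogeneous polynomials, where u_k and v_l are the lowest-degree non-zero terms. If Z(v) ⊆ Z(u), then Z(v_l) ⊆ Z(u_k), i.e., the zero set of the lowest-order homogeneous term of v is contained in the zero set of the lowest-order homogeneous term of u. -/

import Mathlib

open MvPolynomial Filter Topology Asymptotics

/-- `f` is harmonic on `s`: it is `C²` there and its Laplacian vanishes. -/
def IsHarmonicOn {n : ℕ} (f : (Fin n → ℝ) → ℝ) (s : Set (Fin n → ℝ)) : Prop :=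
  ContDiffOn ℝ 2 f s ∧
    ∀ x ∈ s, ∑ i : Fin n, iteratedFDeriv ℝ 2 f x (fun _ => Pi.single i 1) = 0

open MeasureTheory ProbabilityTheory

theorem integrable_pow_gaussianReal (k : ℕ) :
    Integrable (fun x : ℝ => x ^ k) (gaussianReal 0 1) := by
  have h := (memLp_id_gaussianReal' (μ := 0) (v := 1) (k : ENNReal) (by simp)).integrable_norm_pow'
  refine h.mono (by fun_prop) (.of_forall fun x => by simp)

theorem integrable_gaussianPDFReal_mul_pow (k : ℕ) :
    Integrable fun x : ℝ => gaussianPDFReal 0 1 x * x ^ k := by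
  have h := integrable_pow_gaussianReal k
  rw [gaussianReal_of_var_ne_zero _ one_ne_zero, integrable_withDensity_iff_integrable_smul'
    (measurable_gaussianPDF 0 1) (by simp [gaussianPDF])] at h
  simpa [gaussianPDF, gaussianPDFReal_nonneg] using h

theorem hasDerivAt_gaussianPDFReal (x : ℝ) :
    HasDerivAt (gaussianPDFReal 0 1) (-x * gaussianPDFReal 0 1 x) x := by
  have h : HasDerivAt (fun y : ℝ => -(y - 0) ^ 2 / (2 * ((1 : NNReal) : ℝ))) (-x) x := by
    have := ((((hasDerivAt_id x).sub_const 0).pow 2).neg).div_const (2 * ((1 : NNReal) : ℝ))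
    convert! this using 1
    simp [neg_div]
  have := h.exp.const_mul (√(2 * Real.pi * ((1 : NNReal) : ℝ)))⁻¹
  rw [gaussianPDFReal_def]
  convert! this using 1
  ring

/-- The moment recursion of the standard Gaussian. -/
theorem integral_pow_succ_gaussianReal (k : ℕ) :
    ∫ x, x ^ (k + 1) ∂(gaussianReal 0 1) = k * ∫ x, x ^ (k - 1) ∂(gaussianReal 0 1) := by
  simp only [integral_gaussianReal_eq_integral_smul (one_ne_zero), smul_eq_mul]
  have hI := ((integrable_gaussianPDFReal_mul_pow (k - 1)).const_mul (k : ℝ)).sub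
    (integrable_gaussianPDFReal_mul_pow (k + 1))
  have h := integral_eq_zero_of_hasDerivAt_of_integrable
    (f := fun x => gaussianPDFReal 0 1 x * x ^ k)
    (fun x => by
      convert! (hasDerivAt_gaussianPDFReal x).mul (hasDerivAt_pow k x) using 1
      simp only [Pi.sub_apply]
      ring) hI (integrable_gaussianPDFReal_mul_pow k)
  simp only [Pi.sub_apply] at h
  rw [integral_sub ((integrable_gaussianPDFReal_mul_pow (k - 1)).const_mul (k : ℝ))
    (integrable_gaussianPDFReal_mul_pow (k + 1)), integral_const_mul] at h
  linarith

/-- The standard Gaussian measure on `Fin n → ℝ`. -/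
noncomputable abbrev stdGaussianPi (n : ℕ) : Measure (Fin n → ℝ) :=
  Measure.pi fun _ => gaussianReal 0 1

theorem eval_monomial_eq_prod {n : ℕ} (d : Fin n →₀ ℕ) (c : ℝ) (x : Fin n → ℝ) :
    eval x (monomial d c) = c * ∏ i, x i ^ d i := by
  rw [eval_monomial, Finsupp.prod_fintype _ _ fun i => pow_zero _]

theorem integrable_eval_stdGaussianPi {n : ℕ} (p : MvPolynomial (Fin n) ℝ) :
    Integrable (fun x => eval x p) (stdGaussianPi n) := by
  induction p using MvPolynomial.induction_on' with
  | monomial d c =>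
    simp only [eval_monomial_eq_prod]
    exact (Integrable.fintype_prod fun i => integrable_pow_gaussianReal (d i)).const_mul c
  | add p q hp hq => 
    simp only [map_add]
    exact hp.add hq

theorem integral_monomial_stdGaussianPi {n : ℕ} (d : Fin n →₀ ℕ) (c : ℝ) :
    ∫ x, eval x (monomial d c) ∂(stdGaussianPi n) =
      c * ∏ i, ∫ x, x ^ d i ∂(gaussianReal 0 1) := by
  simp only [eval_monomial_eq_prod, integral_const_mul]
  rw [integral_fintype_prod_eq_prod fun i (x : ℝ) => x ^ d i]

/-- Gaussian integration by parts for polynomials. -/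
theorem integral_X_mul_stdGaussianPi {n : ℕ} (i : Fin n) (p : MvPolynomial (Fin n) ℝ) :
    ∫ x, eval x (X i * p) ∂(stdGaussianPi n) =
      ∫ x, eval x (pderiv i p) ∂(stdGaussianPi n) := by
  induction p using MvPolynomial.induction_on' with
  | monomial d c =>
    rw [X, monomial_mul, pderiv_monomial, integral_monomial_stdGaussianPi,
      integral_monomial_stdGaussianPi, ← Finset.mul_prod_erase _ _ (Finset.mem_univ i),
      ← Finset.mul_prod_erase _ _ (Finset.mem_univ i)]
    have h1 : ((Finsupp.single i 1 + d : Fin n →₀ ℕ) i) = d i + 1 := by simp [add_comm]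
    have h2 : ((d - Finsupp.single i 1 : Fin n →₀ ℕ) i) = d i - 1 := by simp
    rw [h1, h2, integral_pow_succ_gaussianReal]
    have h3 : ∏ j ∈ Finset.univ.erase i,
          ∫ x, x ^ ((Finsupp.single i 1 + d : Fin n →₀ ℕ) j) ∂(gaussianReal 0 1) =
        ∏ j ∈ Finset.univ.erase i,
          ∫ x, x ^ ((d - Finsupp.single i 1 : Fin n →₀ ℕ) j) ∂(gaussianReal 0 1) :=
      Finset.prod_congr rfl fun j hj => by
        simp [(Finset.ne_of_mem_erase hj).symm]
    rw [h3]
    ring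
  | add p q hp hq =>
    simp only [mul_add, map_add] at hp hq ⊢
    rw [integral_add (integrable_eval_stdGaussianPi _) (integrable_eval_stdGaussianPi _),
      integral_add (integrable_eval_stdGaussianPi _) (integrable_eval_stdGaussianPi _), hp, hq]

/-- The Laplacian of a polynomial. -/
noncomputable def MvPolynomial.laplacian {n : ℕ} (p : MvPolynomial (Fin n) ℝ) :
    MvPolynomial (Fin n) ℝ :=
  ∑ i, pderiv i (pderiv i p)

/-- A nonnegative harmonic homogeneous polynomial of positive degree vanishes. -/
theorem MvPolynomial.IsHomogeneous.eq_zero_of_laplacian_eq_zero_of_nonneg {n m : ℕ}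
    {p : MvPolynomial (Fin n) ℝ} (hp : p.IsHomogeneous m) (hm : m ≠ 0)
    (hlap : p.laplacian = 0) (hnonneg : ∀ x, 0 ≤ eval x p) : p = 0 := by
  have hint : ∫ x, eval x p ∂(stdGaussianPi n) = 0 := by
    have h : ∫ x, eval x (m • p) ∂(stdGaussianPi n) = 0 := by
      rw [← hp.sum_X_mul_pderiv]
      simp only [map_sum]
      rw [integral_finsetSum _ fun i _ => integrable_eval_stdGaussianPi _]
      simp only [integral_X_mul_stdGaussianPi]
      rw [← integral_finsetSum _ fun i _ => integrable_eval_stdGaussianPi _]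
      simp only [← map_sum]
      rw [← MvPolynomial.laplacian, hlap]
      simp
    simpa [integral_const_mul, hm] using h
  have : (gaussianReal 0 1).IsOpenPosMeasure :=
    (gaussianReal_absolutelyContinuous' 0 one_ne_zero).isOpenPosMeasure
  rw [integral_eq_zero_iff_of_nonneg hnonneg (integrable_eval_stdGaussianPi p)] at hint
  have h := (Continuous.ae_eq_iff_eq _ (MvPolynomial.continuous_eval p) continuous_zero).1 hint
  exact MvPolynomial.funext fun x => by simpa using congrFun h x

/-- Second-order necessary condition for a local minimum. -/
theorem IsLocalMin.second_deriv_nonneg {h h' : ℝ → ℝ} {c x : ℝ} (hmin : IsLocalMin h x)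
    (hh : ∀ᶠ s in 𝓝 x, HasDerivAt h (h' s) s) (hh' : HasDerivAt h' c x) : 0 ≤ c := by
  by_contra! hc
  have hderiv : deriv h =ᶠ[𝓝 x] h' := hh.mono fun s hs => hs.deriv
  have hdd : deriv (deriv h) x = c := by rw [hderiv.deriv_eq, hh'.deriv]
  have hmax := isLocalMax_of_deriv_deriv_neg (hdd.trans_lt hc) hmin.deriv_eq_zero
    hh.self_of_nhds.continuousAt
  have hconst : h =ᶠ[𝓝 x] fun _ => h x := by
    filter_upwards [hmin, hmax] with s hs₁ hs₂ using le_antisymm hs₂ hs₁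
  have : deriv (deriv h) x = 0 := by
    rw [hconst.deriv.deriv_eq]
    simp
  linarith

theorem hasDerivAt_eval_add_smul_single {n : ℕ} (p : MvPolynomial (Fin n) ℝ) (y : Fin n → ℝ)
    (i : Fin n) (s : ℝ) :
    HasDerivAt (fun s : ℝ => eval (y + s • Pi.single i 1) p)
      (eval (y + s • Pi.single i 1) (pderiv i p)) s := by
  induction p using MvPolynomial.induction_on with
  | C c => simpa using hasDerivAt_const s c
  | add p q hp hq => simpa using! hp.add hq
  | mul_X p j hp =>
    have hX : HasDerivAt (fun s : ℝ => y j + s * (Pi.single i 1 : Fin n → ℝ) j)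
        ((Pi.single i 1 : Fin n → ℝ) j) s := by
      simpa using ((hasDerivAt_id s).mul_const ((Pi.single i 1 : Fin n → ℝ) j)).const_add (y j)
    convert! hp.mul hX using 1
    · ext s
      simp
    · rw [Derivation.leibniz, pderiv_X]
      simp only [smul_eq_mul, map_add, map_mul, eval_X, Pi.add_apply, Pi.smul_apply]
      have hsingle : eval (y + s • Pi.single i 1)
          ((Pi.single i 1 : Fin n → MvPolynomial (Fin n) ℝ) j) = (Pi.single i 1 : Fin n → ℝ) j := by
        rcases eq_or_ne j i with rfl | hji
        · simp
        · simp [hji]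
      rw [hsingle]
      ring

theorem ContDiffAt.eventually_hasDerivAt_add_smul {E : Type*} [NormedAddCommGroup E]
    [NormedSpace ℝ E] {f : E → ℝ} {b : E} (hf : ContDiffAt ℝ 2 f b) (w : E) :
    ∀ᶠ s in 𝓝 (0 : ℝ), HasDerivAt (fun s : ℝ => f (b + s • w)) (fderiv ℝ f (b + s • w) w) s := by
  have hc : Tendsto (fun s : ℝ => b + s • w) (𝓝 0) (𝓝 b) := by
    have : Continuous fun s : ℝ => b + s • w := by fun_prop
    simpa using this.tendsto 0
  filter_upwards [hc.eventually (hf.eventually (by simp))] with s hs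
  have hline : HasDerivAt (fun s : ℝ => b + s • w) w s := by
    simpa using ((hasDerivAt_id s).smul_const w).const_add b
  exact (hs.differentiableAt (by simp)).hasFDerivAt.comp_hasDerivAt s hline

theorem ContDiffAt.hasDerivAt_fderiv_add_smul {E : Type*} [NormedAddCommGroup E]
    [NormedSpace ℝ E] {f : E → ℝ} {b : E} (hf : ContDiffAt ℝ 2 f b) (w : E) :
    HasDerivAt (fun s : ℝ => fderiv ℝ f (b + s • w) w) (iteratedFDeriv ℝ 2 f b fun _ => w) 0 := by
  have hline : HasDerivAt (fun s : ℝ => b + s • w) w 0 := by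
    simpa using ((hasDerivAt_id (0 : ℝ)).smul_const w).const_add b
  have hd : DifferentiableAt ℝ (fderiv ℝ f) (b + (0 : ℝ) • w) := by
    simpa using (hf.fderiv_right (m := 1) (by norm_num)).differentiableAt (by simp)
  have h := ((ContinuousLinearMap.apply ℝ ℝ w).hasFDerivAt.comp _ hd.hasFDerivAt).comp_hasDerivAt
    (0 : ℝ) hline
  rw [zero_smul, add_zero] at h
  rw [iteratedFDeriv_two_apply]
  exact h

theorem contDiff_eval {n : ℕ} (p : MvPolynomial (Fin n) ℝ) :
    ContDiff ℝ 2 fun x : Fin n → ℝ => eval x p :=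
  contDiffOn_univ.1 ((AnalyticOnNhd.eval_mvPolynomial p).contDiffOn uniqueDiffOn_univ)

theorem iteratedFDeriv_two_eval_single {n : ℕ} (p : MvPolynomial (Fin n) ℝ) (x : Fin n → ℝ)
    (i : Fin n) :
    iteratedFDeriv ℝ 2 (fun x : Fin n → ℝ => eval x p) x (fun _ => Pi.single i 1) =
      eval x (pderiv i (pderiv i p)) := by
  have hp := (contDiff_eval p).contDiffAt (x := x)
  have hfirst : (fun s : ℝ => fderiv ℝ (fun x : Fin n → ℝ => eval x p)
      (x + s • Pi.single i 1) (Pi.single i 1)) =ᶠ[𝓝 0]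
      fun s : ℝ => eval (x + s • Pi.single i 1) (pderiv i p) := by
    filter_upwards [hp.eventually_hasDerivAt_add_smul (Pi.single i 1)] with s hs
      using hs.unique (hasDerivAt_eval_add_smul_single p x i s)
  have h := (hp.hasDerivAt_fderiv_add_smul (Pi.single i 1)).congr_of_eventuallyEq hfirst.symm
  simpa using h.unique (hasDerivAt_eval_add_smul_single (pderiv i p) x i 0)

theorem isHarmonicOn_eval {n : ℕ} {p : MvPolynomial (Fin n) ℝ} (hp : p.laplacian = 0)
    (s : Set (Fin n → ℝ)) : IsHarmonicOn (fun x => eval x p) s := by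
  refine ⟨(contDiff_eval p).contDiffOn, fun x _ => ?_⟩
  simp only [iteratedFDeriv_two_eval_single]
  rw [← map_sum, ← MvPolynomial.laplacian, hp, map_zero]

theorem IsHarmonicOn.neg {n : ℕ} {f : (Fin n → ℝ) → ℝ} {s : Set (Fin n → ℝ)}
    (hf : IsHarmonicOn f s) : IsHarmonicOn (-f) s := by
  refine ⟨hf.1.neg, fun x hx => ?_⟩
  have h := hf.2 x hx
  simp only [iteratedFDeriv_neg_apply, neg_apply, Finset.sum_neg_distrib,
    h, neg_zero]

theorem MvPolynomial.IsHomogeneous.eval_smul_eq {n m : ℕ} {p : MvPolynomial (Fin n) ℝ}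
    (hp : p.IsHomogeneous m) (t : ℝ) (y : Fin n → ℝ) : eval (t • y) p = t ^ m * eval y p := by
  rw [eval_eq', eval_eq', Finset.mul_sum]
  refine Finset.sum_congr rfl fun d hd => ?_
  have hdeg : ∑ i, d i = m := by
    rw [hp.degree_eq_sum_deg_support hd, ← Finsupp.degree_apply, Finsupp.degree_eq_sum]
  simp only [Pi.smul_apply, smul_eq_mul, mul_pow, Finset.prod_mul_distrib,
    Finset.prod_pow_eq_pow_sum, hdeg]
  ring

/-- A leading homogeneous Taylor term approximates uniformly on balls after rescaling. -/
theorem MvPolynomial.IsHomogeneous.eventually_abs_sub_le {n m : ℕ}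
    {p : MvPolynomial (Fin n) ℝ} (hp : p.IsHomogeneous m) {f : (Fin n → ℝ) → ℝ} {a : Fin n → ℝ}
    (hf : (fun x => f (a + x) - eval x p) =o[𝓝 0] fun x : Fin n → ℝ => ‖x‖ ^ m)
    (R : ℝ) {δ : ℝ} (hδ : 0 < δ) :
    ∀ᶠ t in 𝓝[>] (0 : ℝ), ∀ y : Fin n → ℝ, ‖y‖ ≤ R →
      |f (a + t • y) - t ^ m * eval y p| ≤ δ * t ^ m := by
  have hR : 0 < (|R| + 1) ^ m := by positivity
  obtain ⟨ρ, hρ, hball⟩ := Metric.eventually_nhds_iff.1 (hf.def (div_pos hδ hR))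
  have hsmall : ∀ᶠ t in 𝓝[>] (0 : ℝ), t < ρ / (|R| + 1) :=
    nhdsWithin_le_nhds (Iio_mem_nhds (by positivity))
  filter_upwards [hsmall, self_mem_nhdsWithin] with t ht (ht0 : 0 < t) y hy
  have hyR : ‖y‖ ≤ |R| + 1 := hy.trans ((le_abs_self R).trans (by linarith))
  have hnorm : ‖t • y‖ = t * ‖y‖ := by rw [norm_smul, Real.norm_of_nonneg ht0.le]
  have h := @hball (t • y) (by
    rw [dist_zero_right, hnorm]
    calc t * ‖y‖ ≤ t * (|R| + 1) := by gcongr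
      _ < ρ := (lt_div_iff₀ (by positivity)).1 ht)
  rw [hp.eval_smul_eq, Real.norm_eq_abs, norm_pow, norm_norm, hnorm, mul_pow] at h
  refine h.trans ?_
  calc δ / (|R| + 1) ^ m * (t ^ m * ‖y‖ ^ m)
      ≤ δ / (|R| + 1) ^ m * (t ^ m * (|R| + 1) ^ m) := by gcongr
    _ = δ * t ^ m := by field_simp

theorem IsOpen.eventually_add_smul_mem {E : Type*} [NormedAddCommGroup E] [NormedSpace ℝ E]
    {Ω K : Set E} (hΩ : IsOpen Ω) {a : E} (ha : a ∈ Ω) (hK : IsCompact K) :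
    ∀ᶠ t in 𝓝[>] (0 : ℝ), ∀ y ∈ K, a + t • y ∈ Ω := by
  have hcont : Continuous fun w : ℝ × E => a + w.1 • w.2 := by fun_prop
  refine nhdsWithin_le_nhds (hK.eventually_forall_of_forall_eventually fun y _ => ?_)
  exact (hcont.continuousAt (x := (0, y))).eventually (hΩ.mem_nhds (by simpa using ha))

/-- If a homogeneous polynomial approximates a harmonic function to its own order, then its
Laplacian is nowhere positive. -/
theorem IsHarmonicOn.eval_laplacian_nonpos {n m : ℕ} {Ω : Set (Fin n → ℝ)} (hΩ : IsOpen Ω)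
    {v : (Fin n → ℝ) → ℝ} (hv : IsHarmonicOn v Ω) {a : Fin n → ℝ} (ha : a ∈ Ω)
    {p : MvPolynomial (Fin n) ℝ} (hp : p.IsHomogeneous m)
    (htay : (fun x => v (a + x) - eval x p) =o[𝓝 0] fun x : Fin n → ℝ => ‖x‖ ^ m)
    (z : Fin n → ℝ) : eval z p.laplacian ≤ 0 := by
  by_contra! hpos
  -- subtracting a small paraboloid from `p` keeps the Laplacian positive near `z`
  set ε : ℝ := eval z p.laplacian / (2 * n + 1) with hε_def
  have hε : 0 < ε := by positivity
  set b : MvPolynomial (Fin n) ℝ := ∑ j, (X j - C (z j)) ^ 2 with hb_def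
  have hb_eval (y : Fin n → ℝ) : eval y b = ∑ j, (y j - z j) ^ 2 := by simp [hb_def]
  have hb_lap : b.laplacian = C (2 * (n : ℝ)) := by
    have hterm (i : Fin n) : pderiv i (pderiv i b) = C 2 := by
      have hfirst : pderiv i b = C 2 * (X i - C (z i)) := by
        rw [hb_def, map_sum, Finset.sum_eq_single i]
        · rw [Derivation.leibniz_pow]
          simp [two_mul]
          simp [← two_mul, ← map_ofNat (C (R := ℝ) (σ := Fin n))]
        · intro j _ hj
          rw [Derivation.leibniz_pow]
          simp [pderiv_X_of_ne hj]
        · simp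
      rw [hfirst]
      simp
    simp [MvPolynomial.laplacian, hterm, mul_comm]
  set q : MvPolynomial (Fin n) ℝ := p - C ε * b with hq_def
  have hq_lap : q.laplacian = p.laplacian - C ε * b.laplacian := by
    simp [hq_def, MvPolynomial.laplacian, Finset.mul_sum]
  have hq_pos : 0 < eval z q.laplacian := by
    have : eval z q.laplacian = ε := by
      rw [hq_lap, hb_lap]
      simp only [map_sub, map_mul, eval_C]
      rw [hε_def]
      field_simp
      ring
    rwa [this]
  obtain ⟨r, hr, hball⟩ := Metric.nhds_basis_closedBall.eventually_iff.1
    ((MvPolynomial.continuous_eval q.laplacian).continuousAt.eventually (lt_mem_nhds hq_pos))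
  set K := Metric.closedBall z r
  have hmem := hΩ.eventually_add_smul_mem ha (isCompact_closedBall z r)
  have happrox := hp.eventually_abs_sub_le htay (‖z‖ + r) (δ := ε * r ^ 2 / 3) (by positivity)
  obtain ⟨t, ⟨hmem, happrox⟩, ht : 0 < t⟩ :=
    ((hmem.and happrox).and self_mem_nhdsWithin).exists
  have hK_norm {y} (hy : y ∈ K) : ‖y‖ ≤ ‖z‖ + r := by
    have := norm_le_norm_add_norm_sub z y
    rw [Metric.mem_closedBall, dist_eq_norm'] at hy
    linarith
  set F : (Fin n → ℝ) → ℝ := fun y => v (a + t • y) - t ^ m * eval y q with hF_def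
  have hF_eq (y : Fin n → ℝ) : F y =
      (v (a + t • y) - t ^ m * eval y p) + t ^ m * ε * ∑ j, (y j - z j) ^ 2 := by
    simp only [hF_def, hq_def, map_sub, map_mul, eval_C, hb_eval]
    ring
  have hF_cont : ContinuousOn F K := by
    refine ContinuousOn.sub (hv.1.continuousOn.comp (by fun_prop) hmem) ?_
    exact (continuous_const.mul (MvPolynomial.continuous_eval q)).continuousOn
  have hz : z ∈ K := Metric.mem_closedBall_self hr.le
  obtain ⟨y, hyK, hy_min⟩ := (isCompact_closedBall z r).exists_isMinOn ⟨z, hz⟩ hF_cont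
  -- the minimum cannot lie on the boundary
  have hy_int : y ∈ Metric.ball z r := by
    by_contra hy_not
    have hdist : r ≤ ‖y - z‖ := by
      rwa [Metric.mem_ball, dist_eq_norm, not_lt] at hy_not
    have hsq : r ^ 2 ≤ ∑ j, (y j - z j) ^ 2 := by
      by_contra! hlt
      refine absurd hdist (not_le.2 ((pi_norm_lt_iff hr).2 fun j => ?_))
      rw [Pi.sub_apply, Real.norm_eq_abs]
      refine abs_lt_of_sq_lt_sq ?_ hr.le
      exact (Finset.single_le_sum (f := fun j => (y j - z j) ^ 2) (fun _ _ => sq_nonneg _)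
        (Finset.mem_univ j)).trans_lt hlt
    have h₁ := neg_le_of_abs_le (happrox y (hK_norm hyK))
    have h₂ := le_of_abs_le (happrox z (hK_norm hz))
    have h₃ : F y ≤ F z := hy_min hz
    rw [hF_eq, hF_eq] at h₃
    have htm : 0 < t ^ m := by positivity
    have h₄ : t ^ m * ε * r ^ 2 ≤ t ^ m * ε * ∑ j, (y j - z j) ^ 2 := by gcongr
    have h₅ : 0 < t ^ m * ε * r ^ 2 := by positivity
    simp only [sub_self, ne_eq, OfNat.ofNat_ne_zero, not_false_eq_true, zero_pow,
      Finset.sum_const_zero, mul_zero, add_zero] at h₃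
    linarith
  have hy_loc : IsLocalMin F y := by
    filter_upwards [Metric.closedBall_mem_nhds_of_mem hy_int] with x hx using hy_min hx
  have hv_at : ContDiffAt ℝ 2 v (a + t • y) := hv.1.contDiffAt (hΩ.mem_nhds (hmem y hyK))
  have hsecond (i : Fin n) : 0 ≤ t ^ 2 *
      iteratedFDeriv ℝ 2 v (a + t • y) (fun _ => Pi.single i 1) -
      t ^ m * eval y (pderiv i (pderiv i q)) := by
    have hline : Continuous fun s : ℝ => y + s • (Pi.single i 1 : Fin n → ℝ) := by fun_prop
    have hmin : IsLocalMin (fun s : ℝ => F (y + s • Pi.single i 1)) 0 :=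
      IsLocalMin.comp_continuous (f := F) (by simpa using hy_loc) hline.continuousAt
    have hassoc (s : ℝ) : a + t • (y + s • (Pi.single i 1 : Fin n → ℝ)) =
        a + t • y + s • (t • Pi.single i 1) := by
      rw [smul_add, smul_comm, add_assoc]
    have hpoly := (hasDerivAt_eval_add_smul_single (pderiv i q) y i 0).const_mul (t ^ m)
    simp only [hF_def, hassoc] at hmin
    have h := hmin.second_deriv_nonneg
      (by
        filter_upwards [hv_at.eventually_hasDerivAt_add_smul (t • Pi.single i 1)] with s hs
        exact hs.sub ((hasDerivAt_eval_add_smul_single q y i s).const_mul (t ^ m)))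
      ((hv_at.hasDerivAt_fderiv_add_smul (t • Pi.single i 1)).sub hpoly)
    rw [(iteratedFDeriv ℝ 2 v (a + t • y)).map_smul_univ (fun _ => t)
      (fun _ => Pi.single i 1)] at h
    simpa using h
  have hsum := Finset.sum_nonneg fun i (_ : i ∈ Finset.univ) => hsecond i
  rw [Finset.sum_sub_distrib, ← Finset.mul_sum, ← Finset.mul_sum, hv.2 _ (hmem y hyK), ← map_sum,
    ← MvPolynomial.laplacian] at hsum
  have hprod : 0 < t ^ m * eval y q.laplacian := mul_pos (by positivity) (hball hyK)
  linarith

/-- The leading homogeneous Taylor term of a harmonic function is harmonic. -/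
theorem IsHarmonicOn.laplacian_eq_zero {n m : ℕ} {Ω : Set (Fin n → ℝ)} (hΩ : IsOpen Ω)
    {v : (Fin n → ℝ) → ℝ} (hv : IsHarmonicOn v Ω) {a : Fin n → ℝ} (ha : a ∈ Ω)
    {p : MvPolynomial (Fin n) ℝ} (hp : p.IsHomogeneous m)
    (htay : (fun x => v (a + x) - eval x p) =o[𝓝 0] fun x : Fin n → ℝ => ‖x‖ ^ m) :
    p.laplacian = 0 := by
  refine MvPolynomial.funext fun z => ?_
  have h₁ := hv.eval_laplacian_nonpos hΩ ha hp htay z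
  have h₂ := hv.neg.eval_laplacian_nonpos hΩ ha (p := -p) hp.neg
    (htay.neg_left.congr_left fun x => by simp; ring) z
  simp only [MvPolynomial.laplacian, map_neg, Finset.sum_neg_distrib] at h₁ h₂ ⊢
  rw [map_zero]
  linarith

theorem MvPolynomial.IsHomogeneous.isBigO_eval {n m : ℕ} {p : MvPolynomial (Fin n) ℝ}
    (hp : p.IsHomogeneous m) :
    (fun x : Fin n → ℝ => eval x p) =O[𝓝 0] fun x : Fin n → ℝ => ‖x‖ ^ m := by
  obtain ⟨M, hM⟩ := (isCompact_closedBall (0 : Fin n → ℝ) 1).exists_bound_of_continuousOn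
    (MvPolynomial.continuous_eval p).continuousOn
  refine IsBigO.of_bound M (.of_forall fun x => ?_)
  have hx : x = ‖x‖ • (‖x‖⁻¹ • x) := by
    rcases eq_or_ne x 0 with rfl | hx
    · simp
    · rw [smul_inv_smul₀ (norm_ne_zero_iff.2 hx)]
  have hle : ‖x‖⁻¹ • x ∈ Metric.closedBall (0 : Fin n → ℝ) 1 := by
    rw [mem_closedBall_zero_iff, norm_smul, norm_inv, norm_norm]
    exact inv_mul_le_one
  have h := hM _ hle
  have heval : eval x p = ‖x‖ ^ m * eval (‖x‖⁻¹ • x) p := by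
    rw [← hp.eval_smul_eq, ← hx]
  rw [heval, norm_mul, mul_comm M]
  gcongr

/-- The lowest-order homogeneous Taylor term of a nonzero polynomial at one of its zeros. -/
theorem MvPolynomial.exists_leading_taylor_term {n : ℕ} {p : MvPolynomial (Fin n) ℝ} (hp : p ≠ 0)
    {a : Fin n → ℝ} (ha : eval a p = 0) :
    ∃ (m : ℕ) (q : MvPolynomial (Fin n) ℝ), m ≠ 0 ∧ q ≠ 0 ∧ q.IsHomogeneous m ∧
      (fun x => eval (a + x) p - eval x q) =o[𝓝 0] fun x : Fin n → ℝ => ‖x‖ ^ m := by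
  set Q : MvPolynomial (Fin n) ℝ := bind₁ (fun i => C (a i) + X i) p with hQ_def
  have hQ_eval (x : Fin n → ℝ) : eval x Q = eval (a + x) p := by
    have h := aeval_bind₁ (R := ℝ) x (fun i => C (a i) + X i) p
    have hfun : (fun i => aeval x (C (a i) + X i : MvPolynomial (Fin n) ℝ)) = a + x := by
      ext i
      simp
    rw [hfun] at h
    simpa [hQ_def] using h
  have hQ : Q ≠ 0 := by
    intro hQ
    refine hp (MvPolynomial.funext fun x => ?_)
    simpa [hQ] using (hQ_eval (x - a)).symm
  have hex : ∃ m, homogeneousComponent m Q ≠ 0 := by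
    by_contra! hall
    exact hQ (by rw [← sum_homogeneousComponent Q]; simp [hall])
  classical
  set m := Nat.find hex
  have hm : homogeneousComponent m Q ≠ 0 := Nat.find_spec hex
  refine ⟨m, homogeneousComponent m Q, ?_, hm, homogeneousComponent_isHomogeneous m Q, ?_⟩
  · intro h0
    have hconst : constantCoeff Q = 0 := by rw [← eval_zero, hQ_eval, add_zero, ha]
    rw [h0, homogeneousComponent_zero, ← constantCoeff_eq, hconst, C_0] at hm
    exact hm rfl
  have hm_le : m ∈ Finset.range (Q.totalDegree + 1) := by
    by_contra hnot
    exact hm (homogeneousComponent_eq_zero _ _ (by simpa using hnot))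
  have hdiff (x : Fin n → ℝ) : eval (a + x) p - eval x (homogeneousComponent m Q) =
      ∑ i ∈ (Finset.range (Q.totalDegree + 1)).erase m, eval x (homogeneousComponent i Q) := by
    rw [Finset.sum_erase_eq_sub hm_le, ← map_sum, sum_homogeneousComponent, hQ_eval]
  simp only [hdiff]
  refine IsLittleO.fun_sum fun i hi => ?_
  rcases lt_or_gt_of_ne (Finset.ne_of_mem_erase hi) with hlt | hgt
  · simp [not_not.1 (Nat.find_min hex hlt)]
  · refine (homogeneousComponent_isHomogeneous i Q).isBigO_eval.trans_isLittleO ?_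
    exact (isLittleO_pow_pow hgt).comp_tendsto tendsto_norm_zero

/-- A nonzero harmonic polynomial takes negative values arbitrarily close to each of its zeros. -/
theorem MvPolynomial.frequently_eval_neg {n : ℕ} {p : MvPolynomial (Fin n) ℝ} (hp : p ≠ 0)
    (hlap : p.laplacian = 0) {a : Fin n → ℝ} (ha : eval a p = 0) :
    ∃ᶠ x in 𝓝 a, eval x p < 0 := by
  intro hev
  obtain ⟨m, q, hm, hq0, hq, htay⟩ := exists_leading_taylor_term hp ha
  have hqlap : q.laplacian = 0 := (isHarmonicOn_eval hlap Set.univ).laplacian_eq_zero isOpen_univ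
    (Set.mem_univ a) hq htay
  refine hq0 (hq.eq_zero_of_laplacian_eq_zero_of_nonneg hm hqlap fun y => ?_)
  refine le_of_forall_pos_le_add fun δ hδ => ?_
  have hline : Tendsto (fun t : ℝ => a + t • y) (𝓝[>] 0) (𝓝 a) := by
    have : Continuous fun t : ℝ => a + t • y := by fun_prop
    exact (this.tendsto' 0 a (by simp)).mono_left nhdsWithin_le_nhds
  obtain ⟨t, ⟨happrox, hnonneg⟩, ht : 0 < t⟩ :=
    (((hq.eventually_abs_sub_le (f := fun x => eval x p) htay ‖y‖ hδ).and
      (hline.eventually hev)).and self_mem_nhdsWithin).exists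
  have h := le_of_abs_le (happrox y le_rfl)
  have htm : 0 < t ^ m := by positivity
  nlinarith [not_lt.1 hnonneg]

/-- If `u` is real analytic and `v` is harmonic on a domain `Ω ⊆ ℝⁿ` (`n ≥ 2`), with
lowest-order nonzero homogeneous Taylor terms `uk` (degree `k`) and `vl` (degree `l`)
at a point `a ∈ Ω`, and `Z(v) ⊆ Z(u)`, then `Z(vl) ⊆ Z(uk)`. -/
theorem stmt4 {n : ℕ} (hn : 2 ≤ n) (Ω : Set (Fin n → ℝ)) (hΩ : IsOpen Ω)
    (hconn : IsConnected Ω) (u v : (Fin n → ℝ) → ℝ)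
    (hu : AnalyticOn ℝ u Ω) (hv : IsHarmonicOn v Ω)
    (a : Fin n → ℝ) (ha : a ∈ Ω) (k l : ℕ)
    (uk vl : MvPolynomial (Fin n) ℝ) (huk0 : uk ≠ 0) (hvl0 : vl ≠ 0)
    (hukhom : uk.IsHomogeneous k) (hvlhom : vl.IsHomogeneous l)
    (hutay : (fun x => u (a + x) - eval x uk) =o[𝓝 0] fun x : Fin n → ℝ => ‖x‖ ^ k)
    (hvtay : (fun x => v (a + x) - eval x vl) =o[𝓝 0] fun x : Fin n → ℝ => ‖x‖ ^ l)
    (hZ : ∀ x ∈ Ω, v x = 0 → u x = 0) :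
    ∀ x : Fin n → ℝ, eval x vl = 0 → eval x uk = 0 := by
  intro z hz
  by_contra hne
  have hlap : vl.laplacian = 0 := hv.laplacian_eq_zero hΩ ha hvlhom hvtay
  set c := |eval z uk| / 2 with hc_def
  have hc : 0 < c := by positivity
  obtain ⟨r, hr, hball⟩ := Metric.nhds_basis_ball.eventually_iff.1
    ((MvPolynomial.continuous_eval uk).abs.continuousAt.eventually
      (lt_mem_nhds (show c < |eval z uk| by rw [hc_def]; linarith)))
  obtain ⟨y₁, hy₁, hy₁r⟩ := ((frequently_eval_neg hvl0 hlap hz).and_eventually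
    (Metric.ball_mem_nhds z hr)).exists
  obtain ⟨y₂, hy₂, hy₂r⟩ := ((frequently_eval_neg (neg_ne_zero.2 hvl0)
    (by simpa [MvPolynomial.laplacian] using hlap) (by simpa using hz)).and_eventually
    (Metric.ball_mem_nhds z hr)).exists
  rw [map_neg, neg_lt_zero] at hy₂
  set R := ‖z‖ + r
  have hR {y} (hy : y ∈ Metric.ball z r) : ‖y‖ ≤ R := by
    have := norm_le_norm_add_norm_sub z y
    rw [Metric.mem_ball, dist_eq_norm'] at hy
    linarith
  have hmem := hΩ.eventually_add_smul_mem ha (isCompact_closedBall z r)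
  obtain ⟨t, ⟨⟨⟨hmem, hv₁⟩, hv₂⟩, hu'⟩, ht : 0 < t⟩ :=
    ((((hmem.and (hvlhom.eventually_abs_sub_le hvtay R (half_pos (neg_pos.2 hy₁)))).and
      (hvlhom.eventually_abs_sub_le hvtay R (half_pos hy₂))).and
      (hukhom.eventually_abs_sub_le hutay R hc)).and self_mem_nhdsWithin).exists
  have htl : 0 < t ^ l := by positivity
  have htk : 0 < t ^ k := by positivity
  have hneg : v (a + t • y₁) ≤ 0 := by
    have := le_of_abs_le (hv₁ y₁ (hR hy₁r))
    nlinarith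
  have hpos : 0 ≤ v (a + t • y₂) := by
    have := neg_le_of_abs_le (hv₂ y₂ (hR hy₂r))
    nlinarith
  have hcont : ContinuousOn (fun y => v (a + t • y)) (Metric.ball z r) :=
    hv.1.continuousOn.comp (by fun_prop) fun y hy => hmem y (Metric.ball_subset_closedBall hy)
  obtain ⟨y, hy, hvy⟩ := (convex_ball z r).isPreconnected.intermediate_value hy₁r hy₂r hcont
    ⟨hneg, hpos⟩
  have huy := hZ _ (hmem y (Metric.ball_subset_closedBall hy)) hvy
  have happrox := hu' y (hR hy)
  rw [huy, zero_sub, abs_neg, abs_mul, abs_of_pos htk] at happrox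
  have hbig : c < |eval y uk| := hball hy
  nlinarith
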